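/- Let R = *_{j∈J} R_j be a free product decomposition of a finite-measure-preserving countable Borel equivalence relation on a standard finite measure space (X, μ), trivialized by a partition U = ⊔_{j∈J} U_j. If for some i ∈ J the factor R_i has domain D(R_i) = X and is aperiodic, then the R-saturation of U_i is conull in X and R = R_i almost everywhere. -/

import Mathlib

open MeasureTheory

/-- A countable Borel equivalence relation on `X`, defined on a Borel domain `dom`:
it is Borel as a subset of `X × X`, is an equivalence relation on `dom`, and has
countable classes. -/
structure CBER (X : Type) [MeasurableSpace X] where
  dom : Set X
  dom_meas : MeasurableSet dom
  rel : X → X → Prop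
  rel_meas : MeasurableSet {p : X × X | rel p.1 p.2}
  rel_dom : ∀ {x y : X}, rel x y → x ∈ dom ∧ y ∈ dom
  refl : ∀ x ∈ dom, rel x x
  symm : ∀ {x y : X}, rel x y → rel y x
  trans : ∀ {x y z : X}, rel x y → rel y z → rel x z
  countable_classes : ∀ x : X, {y | rel x y}.Countable

/-- The class of `x`. -/
def CBER.cls {X : Type} [MeasurableSpace X] (R : CBER X) (x : X) : Set X := {y | R.rel x y}

/-- The `R`-saturation of a set `A`: the union of the `R`-classes meeting `A`. -/
def CBER.sat {X : Type} [MeasurableSpace X] (R : CBER X) (A : Set X) : Set X :=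
  {y | ∃ x ∈ A, R.rel x y}

/-- A complete section: a Borel subset of the domain meeting every class. -/
def CBER.IsCompleteSection {X : Type} [MeasurableSpace X] (R : CBER X) (A : Set X) : Prop :=
  MeasurableSet A ∧ A ⊆ R.dom ∧ ∀ x ∈ R.dom, ∃ y ∈ A, R.rel x y

/-- A smooth CBER: one admitting a Borel fundamental domain (a Borel set meeting
every class exactly once). -/
def CBER.Smooth {X : Type} [MeasurableSpace X] (R : CBER X) : Prop :=
  ∃ D : Set X, MeasurableSet D ∧ D ⊆ R.dom ∧ ∀ x ∈ R.dom, ∃! y, y ∈ D ∧ R.rel x y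

/-- Smoothness of the restriction `R|A`. -/
def CBER.SmoothOn {X : Type} [MeasurableSpace X] (R : CBER X) (A : Set X) : Prop :=
  ∃ D : Set X, MeasurableSet D ∧ D ⊆ A ∧ ∀ x ∈ R.dom ∩ A, ∃! y, y ∈ D ∧ R.rel x y

/-- All classes are finite. -/
def CBER.FiniteClasses {X : Type} [MeasurableSpace X] (R : CBER X) : Prop :=
  ∀ x ∈ R.dom, (R.cls x).Finite

/-- Aperiodic: all classes are infinite (on the domain). -/
def CBER.Aperiodic {X : Type} [MeasurableSpace X] (R : CBER X) : Prop :=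
  ∀ x ∈ R.dom, (R.cls x).Infinite

/-- Trivial: all classes are singletons. -/
def CBER.TrivialClasses {X : Type} [MeasurableSpace X] (R : CBER X) : Prop :=
  ∀ x y, R.rel x y → x = y

/-- The restriction `R|U` of `R` to a Borel set `U`. -/
def CBER.restrict {X : Type} [MeasurableSpace X] (R : CBER X) (U : Set X)
    (hU : MeasurableSet U) : CBER X where
  dom := R.dom ∩ U
  dom_meas := R.dom_meas.inter hU
  rel x y := R.rel x y ∧ x ∈ U ∧ y ∈ U
  rel_meas := by
    have h : {p : X × X | R.rel p.1 p.2 ∧ p.1 ∈ U ∧ p.2 ∈ U} =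
        {p : X × X | R.rel p.1 p.2} ∩ (Prod.fst ⁻¹' U ∩ Prod.snd ⁻¹' U) := by
      ext p
      simp only [Set.mem_setOf_eq, Set.mem_inter_iff, Set.mem_preimage, and_assoc]
    rw [h]
    exact R.rel_meas.inter ((measurable_fst hU).inter (measurable_snd hU))
  rel_dom := fun h => ⟨⟨(R.rel_dom h.1).1, h.2.1⟩, ⟨(R.rel_dom h.1).2, h.2.2⟩⟩
  refl := fun x hx => ⟨R.refl x hx.1, hx.2, hx.2⟩
  symm := fun h => ⟨R.symm h.1, h.2.2, h.2.1⟩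
  trans := fun h h' => ⟨R.trans h.1 h'.1, h.2.1, h'.2.2⟩
  countable_classes := fun x =>
    Set.Countable.mono (fun y hy => hy.1) (R.countable_classes x)

/-- `S` is a subrelation of `R`. -/
def CBER.IsSubrelOf {X : Type} [MeasurableSpace X] (S R : CBER X) : Prop :=
  S.dom ⊆ R.dom ∧ ∀ x y, S.rel x y → R.rel x y

/-- A partial Borel isomorphism between Borel subsets `src` and `tgt` of `X`. -/
structure PBI (X : Type) [MeasurableSpace X] where
  src : Set X
  tgt : Set X
  src_meas : MeasurableSet src
  tgt_meas : MeasurableSet tgt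
  toFun : X → X
  invFun : X → X
  meas_toFun : Measurable toFun
  meas_invFun : Measurable invFun
  mapsTo : Set.MapsTo toFun src tgt
  mapsTo_inv : Set.MapsTo invFun tgt src
  left_inv : ∀ x ∈ src, invFun (toFun x) = x
  right_inv : ∀ y ∈ tgt, toFun (invFun y) = y

/-- Membership in the full pseudogroup `[[R]]`: a partial Borel isomorphism whose
graph is contained in `R`. -/
def CBER.InPseudogroup {X : Type} [MeasurableSpace X] (R : CBER X) (φ : PBI X) : Prop :=
  φ.src ⊆ R.dom ∧ ∀ x ∈ φ.src, R.rel x (φ.toFun x)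

/-- Two subrelations `S₁`, `S₂` of `R` are inner conjugate in `R` if some element of the
full pseudogroup of `R` with domain `D(S₂)` and target `D(S₁)` conjugates one to the other. -/
def InnerConjugate {X : Type} [MeasurableSpace X] (R S₁ S₂ : CBER X) : Prop :=
  ∃ φ : PBI X, R.InPseudogroup φ ∧ φ.src = S₂.dom ∧ φ.tgt = S₁.dom ∧
    ∀ x ∈ φ.src, ∀ y ∈ φ.src, (S₂.rel x y ↔ S₁.rel (φ.toFun x) (φ.toFun y))

/-- `R` preserves the measure `μ`: every element of its full pseudogroup preserves `μ`. -/
def CBER.IsPMP {X : Type} [MeasurableSpace X] (R : CBER X) (μ : Measure X) : Prop :=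
  ∀ φ : PBI X, R.InPseudogroup φ → ∀ A : Set X, A ⊆ φ.src → MeasurableSet A →
    μ (φ.toFun '' A) = μ A

/-- Free independence of a family of equivalence relations: any cycle alternating
nontrivially among the factors must have two consecutive steps in the same factor. -/
def FreelyIndep {X : Type} [MeasurableSpace X] {ι : Type} (Rf : ι → CBER X) : Prop :=
  ∀ (n : ℕ) (x : ℕ → X) (i : ℕ → ι), 2 ≤ n → x n = x 0 →
    (∀ j < n, x j ≠ x (j + 1)) → (∀ j < n, (Rf (i j)).rel (x j) (x (j + 1))) →
    ∃ j, j + 1 < n ∧ i j = i (j + 1)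

/-- `R` is the free product of the family `Rf`: the family is freely independent and `R`
is the smallest equivalence relation on the union of the domains containing every `Rf i`. -/
def IsFreeProduct {X : Type} [MeasurableSpace X] {ι : Type} (R : CBER X)
    (Rf : ι → CBER X) : Prop :=
  FreelyIndep Rf ∧ R.dom = (⋃ i, (Rf i).dom) ∧
    ∀ x y, R.rel x y ↔
      (x ∈ R.dom ∧ Relation.EqvGen (fun a b => ∃ i, (Rf i).rel a b) x y)

/-- The partition `U = ⊔ⱼ Uⱼ` trivializes the free product decomposition `R = *ⱼ Rf j`:
`U` is a complete section for `R`, the partition is `R|U`-invariant, and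
`R|Uⱼ = (Rf j)|Uⱼ` for every `j`. -/
def Trivializes {X : Type} [MeasurableSpace X] {ι : Type}
    (R : CBER X) (Rf : ι → CBER X) (U : ι → Set X) : Prop :=
  (∀ j, MeasurableSet (U j)) ∧ (∀ j, U j ⊆ R.dom) ∧
  Pairwise (Function.onFun Disjoint U) ∧
  (∀ x ∈ R.dom, ∃ y ∈ ⋃ j, U j, R.rel x y) ∧
  (∀ i j : ι, ∀ x ∈ U i, ∀ y ∈ U j, R.rel x y → i = j) ∧
  (∀ j, ∀ x ∈ U j, ∀ y ∈ U j, (R.rel x y ↔ (Rf j).rel x y))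

/-- A free product decomposition is inessential if it admits a trivialization. -/
def Inessential {X : Type} [MeasurableSpace X] {ι : Type}
    (R : CBER X) (Rf : ι → CBER X) : Prop :=
  ∃ U : ι → Set X, Trivializes R Rf U

/-- Freely indecomposable (Borel context): every free product decomposition is inessential. -/
def FreelyIndecomposable {X : Type} [MeasurableSpace X] (R : CBER X) : Prop :=
  ∀ (ι : Type) (_ : Countable ι) (Rf : ι → CBER X), IsFreeProduct R Rf → Inessential R Rf

/-- Inessential decomposition in the measured context: a trivialization up to `μ`-null sets. -/
def InessentialMod {X : Type} [MeasurableSpace X] (μ : Measure X) {ι : Type}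
    (R : CBER X) (Rf : ι → CBER X) : Prop :=
  ∃ (U : ι → Set X) (C : Set X),
    (∀ j, MeasurableSet (U j)) ∧ (∀ j, U j ⊆ R.dom) ∧
    Pairwise (Function.onFun Disjoint U) ∧
    MeasurableSet C ∧ μ Cᶜ = 0 ∧
    (∀ x ∈ R.dom ∩ C, ∃ y ∈ ⋃ j, U j, R.rel x y) ∧
    (∀ i j : ι, ∀ x ∈ U i ∩ C, ∀ y ∈ U j ∩ C, R.rel x y → i = j) ∧
    (∀ j, ∀ x ∈ U j ∩ C, ∀ y ∈ U j ∩ C, (R.rel x y ↔ (Rf j).rel x y))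

/-- Freely indecomposable (measured context): every free product decomposition is
inessential up to `μ`-null sets. -/
def FreelyIndecomposableMod {X : Type} [MeasurableSpace X] (μ : Measure X)
    (R : CBER X) : Prop :=
  ∀ (ι : Type) (_ : Countable ι) (Rf : ι → CBER X), IsFreeProduct R Rf →
    InessentialMod μ R Rf

/-- One step of a word in a graphing: apply `φ` (if `e = true`) or `φ⁻¹` (if `e = false`). -/
def PBIStep {X : Type} [MeasurableSpace X] (φ : PBI X) : Bool → X → X → Prop
  | true, a, b => a ∈ φ.src ∧ φ.toFun a = b
  | false, a, b => a ∈ φ.tgt ∧ φ.invFun a = b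

/-- A treeing: any cyclic word in the generators and their inverses admits a reduction. -/
def IsTreeing {X : Type} [MeasurableSpace X] {ι : Type} (Φ : ι → PBI X) : Prop :=
  ∀ (n : ℕ) (i : ℕ → ι) (ε : ℕ → Bool) (x : ℕ → X),
    0 < n → x n = x 0 → (∀ j < n, PBIStep (Φ (i j)) (ε j) (x j) (x (j + 1))) →
    ∃ j, j + 1 < n ∧ i j = i (j + 1) ∧ ε j ≠ ε (j + 1)

/-- The graphing `Φ` generates `R`: `R` is the smallest equivalence relation on the union of
the sources and targets containing the graphs of the `Φ i`. -/
def GeneratesCBER {X : Type} [MeasurableSpace X] {ι : Type} (Φ : ι → PBI X)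
    (R : CBER X) : Prop :=
  R.dom = (⋃ i, ((Φ i).src ∪ (Φ i).tgt)) ∧ (∀ i, R.InPseudogroup (Φ i)) ∧
    ∀ x y, R.rel x y ↔ (x ∈ R.dom ∧
      Relation.EqvGen (fun a b => ∃ i, a ∈ (Φ i).src ∧ (Φ i).toFun a = b) x y)

/-- Treeable: generated by some (countable) treeing. -/
def CBER.Treeable {X : Type} [MeasurableSpace X] (R : CBER X) : Prop :=
  ∃ Φ : ℕ → PBI X, IsTreeing Φ ∧ GeneratesCBER Φ R

/-- Hyperfinite: increasing union of finite Borel subrelations. -/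
def CBER.Hyperfinite {X : Type} [MeasurableSpace X] (R : CBER X) : Prop :=
  ∃ S : ℕ → CBER X, (∀ n, (S n).IsSubrelOf R) ∧ (∀ n, (S n).FiniteClasses) ∧
    (∀ n, (S n).dom = R.dom) ∧ (∀ n, ∀ x y, (S n).rel x y → (S (n + 1)).rel x y) ∧
    ∀ x y, R.rel x y → ∃ n, (S n).rel x y

/-- Ergodicity of a measured CBER: every invariant Borel set is null or conull. -/
def ErgodicCBER {X : Type} [MeasurableSpace X] (R : CBER X) (μ : Measure X) : Prop :=
  ∀ A : Set X, MeasurableSet A → (∀ x ∈ A, ∀ y, R.rel x y → y ∈ A) →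
    μ A = 0 ∨ μ Aᶜ = 0

/-- A stable orbit equivalence between measured CBERs: a Borel isomorphism between
complete sections (mod null sets), sending the normalized measure to the normalized
measure, and preserving the relations a.e. -/
structure SOEquiv {X Y : Type} [MeasurableSpace X] [MeasurableSpace Y]
    (R : CBER X) (μ : Measure X) (S : CBER Y) (ν : Measure Y) where
  A : Set X
  B : Set Y
  toFun : X → Y
  invFun : Y → X
  measA : MeasurableSet A
  measB : MeasurableSet B
  A_sub : A ⊆ R.dom
  B_sub : B ⊆ S.dom
  A_pos : 0 < μ A
  B_pos : 0 < ν B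
  A_section : ∀ᵐ x ∂μ, x ∈ R.dom → ∃ y ∈ A, R.rel x y
  B_section : ∀ᵐ y ∂ν, y ∈ S.dom → ∃ z ∈ B, S.rel y z
  meas_toFun : Measurable toFun
  meas_invFun : Measurable invFun
  mapsTo : Set.MapsTo toFun A B
  mapsTo_inv : Set.MapsTo invFun B A
  left_inv : ∀ x ∈ A, invFun (toFun x) = x
  right_inv : ∀ y ∈ B, toFun (invFun y) = y
  measure_eq : ∀ E : Set X, E ⊆ A → MeasurableSet E →
    (μ A)⁻¹ * μ E = (ν B)⁻¹ * ν (toFun '' E)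
  rel_iff : ∃ C : Set X, MeasurableSet C ∧ μ (A \ C) = 0 ∧
    ∀ x ∈ A ∩ C, ∀ y ∈ A ∩ C, (R.rel x y ↔ S.rel (toFun x) (toFun y))

/-- Stable orbit equivalence. -/
def SOE {X Y : Type} [MeasurableSpace X] [MeasurableSpace Y]
    (R : CBER X) (μ : Measure X) (S : CBER Y) (ν : Measure Y) : Prop :=
  Nonempty (SOEquiv R μ S ν)

/-- Orbit equivalence: a stable orbit equivalence where one can take the complete
sections to be the full spaces. -/
def OE {X Y : Type} [MeasurableSpace X] [MeasurableSpace Y]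
    (R : CBER X) (μ : Measure X) (S : CBER Y) (ν : Measure Y) : Prop :=
  ∃ E : SOEquiv R μ S ν, E.A = Set.univ ∧ E.B = Set.univ

/-- A probability measure preserving action of a group `G` on a measured space. -/
structure PMPAction (G : Type) [Group G] (X : Type) [MeasurableSpace X]
    (μ : Measure X) where
  act : G → X → X
  act_one : ∀ x, act 1 x = x
  act_mul : ∀ g h x, act (g * h) x = act g (act h x)
  measurePreserving : ∀ g, MeasurePreserving (act g) μ μ

/-- Essential freeness: a.e. point has trivial stabilizer. -/
def PMPAction.IsFree {G X : Type} [Group G] [MeasurableSpace X] {μ : Measure X}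
    (α : PMPAction G X μ) : Prop :=
  ∀ᵐ x ∂μ, ∀ g : G, α.act g x = x → g = 1

/-- `R` is the orbit equivalence relation of the action `α` restricted to the subgroup `H`. -/
def IsOrbitRel {G X : Type} [Group G] [MeasurableSpace X] {μ : Measure X}
    (α : PMPAction G X μ) (H : Subgroup G) (R : CBER X) : Prop :=
  R.dom = Set.univ ∧ ∀ x y, (R.rel x y ↔ ∃ g ∈ H, α.act g x = y)

/-- A countable group is measurably freely indecomposable (MFI) if the orbit equivalence
relation of every free p.m.p. action of it on a standard probability space is freely
indecomposable. -/
def MFI (G : Type) [Group G] [Countable G] : Prop :=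
  ∀ (X : Type) [MeasurableSpace X] [StandardBorelSpace X]
    (μ : Measure X) [IsProbabilityMeasure μ]
    (α : PMPAction G X μ) (R : CBER X),
    α.IsFree → IsOrbitRel α ⊤ R → FreelyIndecomposableMod μ R

/-- `G` is the internal free product of the family of subgroups `H`. -/
def IsFreeProductOf (G : Type) [Group G] {ι : Type} (H : ι → Subgroup G) : Prop :=
  Function.Bijective (Monoid.CoprodI.lift fun i => (H i).subtype)

/-- A Borel fundamental domain for an action, of the coupling kind: meets a.e. orbit,
and meets each orbit at most once mod null. -/
def IsFundamentalDomainFor {G : Type} [Group G] {Ω : Type} [MeasurableSpace Ω]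
    (ν : Measure Ω) (a : G → Ω → Ω) (D : Set Ω) : Prop :=
  MeasurableSet D ∧ (∀ᵐ x ∂ν, ∃ g : G, a g x ∈ D) ∧
    ∀ g : G, g ≠ 1 → ν (D ∩ a g ⁻¹' D) = 0

/-- A measure equivalence coupling between `G` and `H`: a standard σ-finite measure space
with commuting measure-preserving essentially free actions of `G` and `H`, each admitting
a Borel fundamental domain of finite positive measure. -/
structure MECoupling (G : Type) [Group G] (H : Type) [Group H] where
  (Ω : Type)
  [mΩ : MeasurableSpace Ω]
  [sbΩ : StandardBorelSpace Ω]
  (ν : Measure Ω)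
  sigmaFinite : SigmaFinite ν
  aG : G → Ω → Ω
  aH : H → Ω → Ω
  DG : Set Ω
  DH : Set Ω
  aG_one : ∀ x, aG 1 x = x
  aG_mul : ∀ g g' x, aG (g * g') x = aG g (aG g' x)
  aH_one : ∀ x, aH 1 x = x
  aH_mul : ∀ h h' x, aH (h * h') x = aH h (aH h' x)
  comm : ∀ g h x, aG g (aH h x) = aH h (aG g x)
  mp_aG : ∀ g, MeasurePreserving (aG g) ν ν
  mp_aH : ∀ h, MeasurePreserving (aH h) ν ν
  free_aG : ∀ᵐ x ∂ν, ∀ g, aG g x = x → g = 1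
  free_aH : ∀ᵐ x ∂ν, ∀ h, aH h x = x → h = 1
  fund_DG : IsFundamentalDomainFor ν aG DG
  fund_DH : IsFundamentalDomainFor ν aH DH
  DG_pos : 0 < ν DG
  DG_fin : ν DG < ⊤
  DH_pos : 0 < ν DH
  DH_fin : ν DH < ⊤

/-- The generalized index (compression constant) of a measure equivalence coupling. -/
noncomputable def MECoupling.index {G : Type} [Group G] {H : Type} [Group H]
    (c : MECoupling G H) : ENNReal :=
  c.ν c.DH / c.ν c.DG

/-- Measure equivalence of countable groups. -/
def MeasureEquivalent (G : Type) [Group G] (H : Type) [Group H] : Prop :=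
  Nonempty (MECoupling G H)

/-- Measure equivalence with a prescribed generalized index. -/
def MEwithIndex (G : Type) [Group G] (H : Type) [Group H] (κ : ENNReal) : Prop :=
  ∃ c : MECoupling G H, c.index = κ

/-- `A` is covered by countably many Borel sets on which `f` is injective. -/
def SigmaInjective {Z X : Type} [MeasurableSpace Z] (f : Z → X) (A : Set Z) : Prop :=
  ∃ B : ℕ → Set Z, (∀ n, MeasurableSet (B n)) ∧ (∀ n, Set.InjOn f (B n)) ∧ A ⊆ ⋃ n, B n

namespace SigmaInjective

variable {Z X : Type} [MeasurableSpace Z] {f : Z → X}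

theorem mono {A A' : Set Z} (h : SigmaInjective f A') (hA : A ⊆ A') : SigmaInjective f A := by
  obtain ⟨B, hB, hi, hc⟩ := h
  exact ⟨B, hB, hi, hA.trans hc⟩

theorem of_injOn {A : Set Z} (hA : MeasurableSet A) (hi : Set.InjOn f A) : SigmaInjective f A :=
  ⟨fun _ => A, fun _ => hA, fun _ => hi, fun _ hz => Set.mem_iUnion.2 ⟨0, hz⟩⟩

theorem empty : SigmaInjective f ∅ := of_injOn MeasurableSet.empty (Set.injOn_empty f)

theorem iUnion_nat {A : ℕ → Set Z} (h : ∀ n, SigmaInjective f (A n)) :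
    SigmaInjective f (⋃ n, A n) := by
  choose B hB hi hc using h
  refine ⟨fun k => B k.unpair.1 k.unpair.2, fun _ => hB _ _, fun _ => hi _ _, ?_⟩
  refine Set.iUnion_subset fun n z hz => ?_
  obtain ⟨m, hm⟩ := Set.mem_iUnion.1 (hc n hz)
  exact Set.mem_iUnion.2 ⟨Nat.pair n m, by simpa using hm⟩

theorem iUnion {ι : Type*} [Countable ι] {A : ι → Set Z} (h : ∀ n, SigmaInjective f (A n)) :
    SigmaInjective f (⋃ n, A n) := by
  rcases isEmpty_or_nonempty ι with hι | hι
  · simpa using empty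
  · obtain ⟨e, he⟩ := exists_surjective_nat ι
    rw [← he.iUnion_comp]
    exact iUnion_nat fun n => h (e n)

theorem biUnion {ι : Type*} {T : Set ι} (hT : T.Countable) {A : ι → Set Z}
    (h : ∀ n ∈ T, SigmaInjective f (A n)) : SigmaInjective f (⋃ n ∈ T, A n) := by
  have := hT.to_subtype
  rw [Set.biUnion_eq_iUnion]
  exact iUnion fun n => h n n.2

theorem union {A A' : Set Z} (h : SigmaInjective f A) (h' : SigmaInjective f A') :
    SigmaInjective f (A ∪ A') := by
  rw [Set.union_eq_iUnion]
  exact iUnion fun b => by cases b <;> assumption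

/-- Every `A` has a smallest (modulo null sets) measurable set of base points over which it fails
to be covered by countably many injective pieces. -/
theorem exists_core [MeasurableSpace X] (f : Z → X) (μ : Measure X) [IsFiniteMeasure μ]
    (A : Set Z) : ∃ H : Set X, MeasurableSet H ∧ SigmaInjective f (A \ f ⁻¹' H) ∧
      ∀ Q, MeasurableSet Q → SigmaInjective f (A ∩ f ⁻¹' Q) → μ (H ∩ Q) = 0 := by
  let S : Set ENNReal := {r | ∃ Q, MeasurableSet Q ∧ SigmaInjective f (A \ f ⁻¹' Q) ∧ μ Q = r}
  have hS : S.Nonempty := ⟨_, Set.univ, MeasurableSet.univ, by simpa using empty, rfl⟩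
  obtain ⟨u, -, hu, huS⟩ := exists_seq_tendsto_sInf hS (OrderBot.bddBelow S)
  choose Q hQ hI hm using huS
  have hH : MeasurableSet (⋂ n, Q n) := MeasurableSet.iInter hQ
  have hHI : SigmaInjective f (A \ f ⁻¹' ⋂ n, Q n) := by
    rw [Set.preimage_iInter, Set.sdiff_iInter]
    exact iUnion hI
  have hle : μ (⋂ n, Q n) ≤ sInf S :=
    ge_of_tendsto' hu fun n => (measure_mono (Set.iInter_subset Q n)).trans (hm n).le
  refine ⟨_, hH, hHI, fun P hP hPI => ?_⟩
  have hmem : μ ((⋂ n, Q n) \ P) ∈ S := by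
    refine ⟨_, hH.diff hP, (hHI.union hPI).mono ?_, rfl⟩
    intro z hz
    by_cases hzP : f z ∈ P
    · exact Or.inr ⟨hz.1, hzP⟩
    · exact Or.inl ⟨hz.1, fun h => hz.2 ⟨h, hzP⟩⟩
  have h1 : μ (⋂ n, Q n) ≤ μ ((⋂ n, Q n) \ P) := hle.trans (sInf_le hmem)
  have h2 := measure_inter_add_sdiff (μ := μ) (⋂ n, Q n) hP
  have h3 : μ ((⋂ n, Q n) ∩ P) + μ ((⋂ n, Q n) \ P) ≤ 0 + μ ((⋂ n, Q n) \ P) := by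
    rw [h2, zero_add]; exact h1
  exact nonpos_iff_eq_zero.1 ((ENNReal.add_le_add_iff_right (measure_ne_top _ _)).1 h3)

end SigmaInjective

open TopologicalSpace in
/-- Measure-theoretic Lusin–Novikov theorem for continuous maps. -/
theorem exists_null_sigmaInjective_of_continuous {Z X : Type} [TopologicalSpace Z]
    [PolishSpace Z] [MeasurableSpace Z] [BorelSpace Z]
    [TopologicalSpace X] [T2Space X] [MeasurableSpace X] [BorelSpace X]
    (μ : Measure X) [IsFiniteMeasure μ] {f : Z → X} (hf : Continuous f)
    (hc : ∀ x, (f ⁻¹' {x}).Countable) :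
    ∃ N, MeasurableSet N ∧ μ N = 0 ∧ SigmaInjective f (f ⁻¹' Nᶜ) := by
  let := upgradeIsCompletelyMetrizable Z
  choose H hHm hHI hHQ using SigmaInjective.exists_core f μ
  have hbc := countable_countableBasis Z
  have hb := isBasis_countableBasis Z
  set b := countableBasis Z
  -- countable subadditivity of the core
  have cover : ∀ V : Set Z, ∀ T : Set (Set Z), T ⊆ b → V ⊆ ⋃₀ T →
      ∀ᵐ x ∂μ, x ∈ H V → ∃ W ∈ T, x ∈ H W := by
    intro V T hT hV
    have hTc := hbc.mono hT
    have hQ : MeasurableSet (⋃ W ∈ T, H W) := MeasurableSet.biUnion hTc fun W _ => hHm W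
    have h0 := hHQ V _ hQ.compl (by
      refine (SigmaInjective.biUnion hTc fun W _ => hHI W).mono ?_
      rintro z ⟨hzV, hz⟩
      obtain ⟨W, hW, hzW⟩ := hV hzV
      exact Set.mem_biUnion hW ⟨hzW, fun h => hz (Set.mem_biUnion hW h)⟩)
    rw [ae_iff]
    refine measure_mono_null (fun x hx => ?_) h0
    simp only [Set.mem_ofPred_eq, not_forall, not_exists, not_and] at hx
    obtain ⟨h1, h2⟩ := hx
    refine ⟨h1, fun h => ?_⟩
    obtain ⟨W, hW, hxW⟩ := Set.mem_iUnion₂.1 h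
    exact h2 W hW hxW
  have mono : ∀ᵐ x ∂μ, ∀ V ∈ b, ∀ W ∈ b, V ⊆ W → x ∈ H V → x ∈ H W := by
    refine (ae_ball_iff hbc).2 fun V _ => (ae_ball_iff hbc).2 fun W hW => ?_
    by_cases hVW : V ⊆ W
    · filter_upwards [cover V {W} (by simpa using hW) (by simpa using hVW)] with x hx _ h
      simpa using hx h
    · exact .of_forall fun x h => absurd h hVW
  have shrink : ∀ᵐ x ∂μ, ∀ V ∈ b, ∀ n : ℕ, x ∈ H V → ∃ W ∈ b, closure W ⊆ V ∧
      (∀ p ∈ W, ∀ q ∈ W, dist p q ≤ (1 / 2) ^ n) ∧ x ∈ H W := by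
    refine (ae_ball_iff hbc).2 fun V hV => ae_all_iff.2 fun n => ?_
    have hcov : V ⊆ ⋃₀ {W | W ∈ b ∧ closure W ⊆ V ∧
        ∀ p ∈ W, ∀ q ∈ W, dist p q ≤ (1 / 2 : ℝ) ^ n} := by
      intro z hz
      obtain ⟨r, hr, hrV⟩ := Metric.nhds_basis_closedBall.mem_iff.1 ((hb.isOpen hV).mem_nhds hz)
      have hs : (0 : ℝ) < min r ((1 / 2) ^ n / 2) := by positivity
      obtain ⟨W, hW, hzW, hWs⟩ := hb.exists_subset_of_mem_open (Metric.mem_ball_self hs)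
        Metric.isOpen_ball
      refine ⟨W, ⟨hW, ?_, fun p hp q hq => ?_⟩, hzW⟩
      · exact (closure_mono hWs).trans (Metric.closure_ball_subset_closedBall.trans
          ((Metric.closedBall_subset_closedBall (min_le_left _ _)).trans hrV))
      · have h1 := Metric.mem_ball.1 (hWs hp)
        have h2 := Metric.mem_ball.1 (hWs hq)
        have h3 := dist_triangle_right p q z
        have h4 := min_le_right r ((1 / 2 : ℝ) ^ n / 2)
        linarith
    filter_upwards [cover V _ (fun W hW => hW.1) hcov] with x hx h
    obtain ⟨W, hW, hxW⟩ := hx h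
    exact ⟨W, hW.1, hW.2.1, hW.2.2, hxW⟩
  have adherent : ∀ᵐ x ∂μ, ∀ V ∈ b, x ∈ H V → x ∈ closure (f '' V) := by
    refine (ae_ball_iff hbc).2 fun V _ => ?_
    have h0 := hHQ V (closure (f '' V))ᶜ isClosed_closure.measurableSet.compl
      (SigmaInjective.empty.mono fun z hz => hz.2 (subset_closure ⟨z, hz.1, rfl⟩))
    rw [ae_iff]
    refine measure_mono_null (fun x hx => ?_) h0
    simpa [Classical.not_imp] using hx
  have split : ∀ᵐ x ∂μ, ∀ V ∈ b, x ∈ H V → ∃ W ∈ b, ∃ W' ∈ b, W ⊆ V ∧ W' ⊆ V ∧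
      Disjoint W W' ∧ x ∈ H W ∧ x ∈ H W' := by
    refine (ae_ball_iff hbc).2 fun V hV => ?_
    let P : Set X := ⋃ W ∈ b, ⋃ W' ∈ b, ⋃ _ : W ⊆ V ∧ W' ⊆ V ∧ Disjoint W W', H W ∩ H W'
    have hP : MeasurableSet P := MeasurableSet.biUnion hbc fun W _ =>
      MeasurableSet.biUnion hbc fun W' _ => MeasurableSet.iUnion fun _ => (hHm W).inter (hHm W')
    have hbad : MeasurableSet (⋃ W ∈ b, W \ f ⁻¹' H W) := MeasurableSet.biUnion hbc fun W hW =>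
      (hb.isOpen hW).measurableSet.diff (hf.measurable (hHm W))
    have h0 := hHQ V Pᶜ hP.compl (by
      refine ((SigmaInjective.biUnion hbc fun W _ => hHI W).union
        (SigmaInjective.of_injOn (A := (V ∩ f ⁻¹' Pᶜ) \ ⋃ W ∈ b, W \ f ⁻¹' H W) ?_ ?_)).mono ?_
      · exact ((hb.isOpen hV).measurableSet.inter (hf.measurable hP.compl)).diff hbad
      · rintro z ⟨⟨hzV, hzP⟩, hz⟩ z' ⟨⟨hzV', -⟩, hz'⟩ hzz
        by_contra hne
        obtain ⟨O, O', hO, hO', hzO, hzO', hd⟩ := t2_separation hne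
        obtain ⟨W, hW, hzW, hWO⟩ := hb.exists_subset_of_mem_open
          (Set.mem_inter hzV hzO) ((hb.isOpen hV).inter hO)
        obtain ⟨W', hW', hzW', hWO'⟩ := hb.exists_subset_of_mem_open
          (Set.mem_inter hzV' hzO') ((hb.isOpen hV).inter hO')
        refine hzP (Set.mem_biUnion hW (Set.mem_biUnion hW' (Set.mem_iUnion.2 ⟨⟨?_, ?_, ?_⟩, ?_, ?_⟩)))
        · exact hWO.trans Set.inter_subset_left
        · exact hWO'.trans Set.inter_subset_left
        · exact hd.mono (hWO.trans Set.inter_subset_right) (hWO'.trans Set.inter_subset_right)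
        · by_contra h
          exact hz (Set.mem_biUnion hW ⟨hzW, h⟩)
        · by_contra h
          exact hz' (Set.mem_biUnion hW' ⟨hzW', fun h' => h (by rw [hzz]; exact h')⟩)
      · intro z hz
        by_cases h : z ∈ ⋃ W ∈ b, W \ f ⁻¹' H W
        · exact Or.inl h
        · exact Or.inr ⟨hz, h⟩)
    rw [ae_iff]
    refine measure_mono_null (fun x hx => ?_) h0
    simp only [Set.mem_ofPred_eq, Classical.not_imp] at hx
    refine ⟨hx.1, fun h => hx.2 ?_⟩
    simp only [P, Set.mem_iUnion] at h
    obtain ⟨W, hW, W', hW', ⟨h1, h2, h3⟩, h4, h5⟩ := h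
    exact ⟨W, hW, W', hW', h1, h2, h3, h4, h5⟩
  have key : ∀ᵐ x ∂μ, ∀ V ∈ b, x ∉ H V := by
    filter_upwards [mono, shrink, adherent, split] with x hmono hshrink hadh hsplit V₀ hV₀ hx₀
    let S : Set Z := {z | ∀ W ∈ b, z ∈ W → x ∈ H W}
    have hne : ∀ V ∈ b, x ∈ H V → (S ∩ V).Nonempty := by
      intro V hV hx
      choose! next hnb hncl hnd hnx using hshrink
      let C : ℕ → Set Z := fun n => Nat.rec V (fun n W => next W n) n
      have hC : ∀ n, C n ∈ b ∧ x ∈ H (C n) := by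
        intro n
        induction n with
        | zero => exact ⟨hV, hx⟩
        | succ n ih => exact ⟨hnb _ ih.1 n ih.2, hnx _ ih.1 n ih.2⟩
      have hCs : ∀ n, closure (C (n + 1)) ⊆ C n := fun n => hncl _ (hC n).1 n (hC n).2
      have hCd : ∀ n, ∀ p ∈ C (n + 1), ∀ q ∈ C (n + 1), dist p q ≤ (1 / 2) ^ n :=
        fun n => hnd _ (hC n).1 n (hC n).2
      have hanti : Antitone C := antitone_nat_of_succ_le fun n => subset_closure.trans (hCs n)
      have hCne : ∀ n, (C n).Nonempty := fun n => by
        have := hadh _ (hC n).1 (hC n).2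
        exact (closure_nonempty_iff.1 ⟨x, this⟩).of_image
      choose p hp using hCne
      have hcau : CauchySeq fun n => p (n + 1) := by
        refine cauchySeq_of_le_geometric (1 / 2) 1 (by norm_num) fun n => ?_
        rw [one_mul]
        exact hCd n _ (hp (n + 1)) _ (hanti (Nat.le_succ (n + 1)) (hp (n + 1 + 1)))
      obtain ⟨z, hz⟩ := cauchySeq_tendsto_of_complete hcau
      have hzC : ∀ n, z ∈ C n := fun n => hCs n (mem_closure_of_tendsto hz (by
        filter_upwards [Filter.eventually_ge_atTop n] with m hm
        exact hanti (show n + 1 ≤ m + 1 by omega) (hp (m + 1))))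
      refine ⟨z, fun W hW hzW => ?_, hzC 0⟩
      obtain ⟨r, hr, hrW⟩ := Metric.isOpen_iff.1 (hb.isOpen hW) z hzW
      obtain ⟨n, hn⟩ := exists_pow_lt_of_lt_one hr (by norm_num : (1 / 2 : ℝ) < 1)
      refine hmono _ (hC (n + 1)).1 W hW (fun q hq => hrW ?_) (hC (n + 1)).2
      exact Metric.mem_ball.2 ((hCd n q hq z (hzC (n + 1))).trans_lt hn)
    have hSf : S ⊆ f ⁻¹' {x} := by
      intro z hz
      by_contra hzx
      have hzx' : f z ≠ x := hzx
      obtain ⟨O, hO, hzO, hxO⟩ : ∃ O : Set X, IsOpen O ∧ f z ∈ O ∧ x ∉ closure O := by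
        obtain ⟨O, O', hO, hO', hzO, hxO', hd⟩ := t2_separation hzx'
        exact ⟨O, hO, hzO, fun h => (hd.closure_left hO').le_bot ⟨h, hxO'⟩⟩
      obtain ⟨W, hW, hzW, hWO⟩ := hb.exists_subset_of_mem_open (a := z) (u := f ⁻¹' O) hzO
        (hO.preimage hf)
      exact hxO (closure_mono (Set.image_subset_iff.2 hWO) (hadh W hW (hz W hW hzW)))
    have hperf : Perfect S := by
      refine ⟨?_, preperfect_iff_nhds.2 fun z hz O hO => ?_⟩
      · rw [← isOpen_compl_iff, isOpen_iff_forall_mem_open]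
        intro z hz
        simp only [S, Set.mem_compl_iff, Set.mem_ofPred_eq, not_forall] at hz
        obtain ⟨W, hW, hzW, hx⟩ := hz
        exact ⟨W, fun w hw hwS => hx (hwS W hW hw), hb.isOpen hW, hzW⟩
      · obtain ⟨V, hV, hzV, hVO⟩ := hb.mem_nhds_iff.1 hO
        obtain ⟨W, hW, W', hW', hWV, hWV', hd, hxW, hxW'⟩ := hsplit V hV (hz V hV hzV)
        obtain ⟨w, hwS, hw⟩ := hne W hW hxW
        obtain ⟨w', hwS', hw'⟩ := hne W' hW' hxW'
        by_cases h : w = z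
        · refine ⟨w', ⟨hVO (hWV' hw'), hwS'⟩, fun h' => hd.le_bot ⟨hw, ?_⟩⟩
          rw [h, ← h']; exact hw'
        · exact ⟨w, ⟨hVO (hWV hw), hwS⟩, h⟩
    obtain ⟨e, heS, -, hei⟩ := hperf.exists_nat_bool_injection
      ((hne V₀ hV₀ hx₀).mono Set.inter_subset_left)
    have hcount : (Set.range e).Countable := (hc x).mono (heS.trans hSf)
    have := hcount.to_subtype
    have hle := Cardinal.mk_le_aleph0_iff.2 (Equiv.ofInjective e hei).injective.countable
    exact hle.not_gt (by simpa using Cardinal.aleph0_lt_continuum)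
  obtain ⟨N, hN, hNm, hN0⟩ := exists_measurable_superset_of_null (ae_iff.1 key)
  refine ⟨N, hNm, hN0, (SigmaInjective.biUnion hbc fun W _ => hHI W).mono fun z hz => ?_⟩
  obtain ⟨V, hV, hzV, -⟩ := hb.exists_subset_of_mem_open (Set.mem_univ z) isOpen_univ
  refine Set.mem_biUnion hV ⟨hzV, fun h => hz (hN ?_)⟩
  simp only [Set.mem_ofPred_eq, not_forall, not_not]
  exact ⟨V, hV, h⟩

/-- Measure-theoretic Lusin–Novikov theorem: off a null set of base points, a countable-to-one
measurable map between standard Borel spaces is injective on each of countably many Borel pieces. -/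
theorem exists_null_sigmaInjective {Z X : Type} [MeasurableSpace Z] [StandardBorelSpace Z]
    [MeasurableSpace X] [StandardBorelSpace X] (μ : Measure X) [IsFiniteMeasure μ] {f : Z → X}
    (hf : Measurable f) (hc : ∀ x, (f ⁻¹' {x}).Countable) :
    ∃ N, MeasurableSet N ∧ μ N = 0 ∧ SigmaInjective f (f ⁻¹' Nᶜ) := by
  let := upgradeStandardBorel X
  let := upgradeStandardBorel Z
  let tZ : TopologicalSpace Z := inferInstance
  obtain ⟨t, ht, hft, hp⟩ : ∃ t : TopologicalSpace Z, t ≤ tZ ∧ @Continuous Z X t _ f ∧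
      @PolishSpace Z t := hf.exists_continuous
  have hB : @BorelSpace Z t _ := @BorelSpace.mk _ t _ (by
    rw [borel_eq_borel_of_le hp (t' := tZ) inferInstance ht]
    exact eq_borel_upgradeStandardBorel Z)
  exact @exists_null_sigmaInjective_of_continuous Z X t hp _ hB _ _ _ _ μ _ f hft hc

/-- A partially defined map `p z ↦ q z`, with `p` injective on the Borel set `B`, extends by the
identity to a measurable map. -/
theorem exists_measurable_extension {Z X : Type} [MeasurableSpace Z] [StandardBorelSpace Z]
    [MeasurableSpace X] [StandardBorelSpace X] {p q : Z → X} (hp : Measurable p)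
    (hq : Measurable q) {B : Set Z} (hB : MeasurableSet B) (hi : Set.InjOn p B) :
    ∃ g : X → X, Measurable g ∧ (∀ z ∈ B, g (p z) = q z) ∧ ∀ x, x ∉ p '' B → g x = x := by
  classical
  let g : X → X := fun x => if h : x ∈ p '' B then q h.choose else x
  have hg : ∀ z ∈ B, g (p z) = q z := by
    intro z hz
    have h : p z ∈ p '' B := ⟨z, hz, rfl⟩
    simp only [g, dif_pos h]
    rw [hi h.choose_spec.1 hz h.choose_spec.2]
  have hg' : ∀ x, x ∉ p '' B → g x = x := fun x hx => dif_neg hx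
  refine ⟨g, fun C hC => ?_, hg, hg'⟩
  have : g ⁻¹' C = p '' (B ∩ q ⁻¹' C) ∪ ((p '' B)ᶜ ∩ C) := by
    ext x
    constructor
    · intro hx
      by_cases h : x ∈ p '' B
      · obtain ⟨z, hz, rfl⟩ := h
        exact Or.inl ⟨z, ⟨hz, by rw [Set.mem_preimage, hg z hz] at hx; exact hx⟩, rfl⟩
      · exact Or.inr ⟨h, by rw [Set.mem_preimage, hg' x h] at hx; exact hx⟩
    · rintro (⟨z, ⟨hz, hzC⟩, rfl⟩ | ⟨h, hx⟩)
      · rw [Set.mem_preimage, hg z hz]; exact hzC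
      · rw [Set.mem_preimage, hg' x h]; exact hx
  rw [this]
  exact ((hB.inter (hq hC)).image_of_measurable_injOn hp (hi.mono Set.inter_subset_left)).union
    ((hB.image_of_measurable_injOn hp hi).compl.inter hC)

namespace CBER

variable {X : Type} [MeasurableSpace X] [StandardBorelSpace X] {R : CBER X} {μ : Measure X}

theorem IsPMP.measure_image (hpmp : R.IsPMP μ) {g : X → X} (hg : Measurable g) {B : Set X}
    (hB : MeasurableSet B) (hi : Set.InjOn g B) (hR : ∀ x ∈ B, R.rel x (g x)) :
    μ (g '' B) = μ B := by
  obtain ⟨k, hk, hkg, -⟩ := exists_measurable_extension hg measurable_id hB hi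
  let φ : PBI X :=
    { src := B
      tgt := g '' B
      src_meas := hB
      tgt_meas := hB.image_of_measurable_injOn hg hi
      toFun := g
      invFun := k
      meas_toFun := hg
      meas_invFun := hk
      mapsTo := Set.mapsTo_image g B
      mapsTo_inv := by
        rintro _ ⟨x, hx, rfl⟩
        rw [hkg x hx]
        exact hx
      left_inv := hkg
      right_inv := by
        rintro _ ⟨x, hx, rfl⟩
        rw [hkg x hx, id] }
  exact hpmp φ ⟨fun x hx => (R.rel_dom (hR x hx)).1, hR⟩ B subset_rfl hB

theorem IsPMP.measure_preimage_null [IsFiniteMeasure μ] (hpmp : R.IsPMP μ) {g : X → X}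
    (hg : Measurable g) (hR : ∀ x, R.rel x (g x)) {N : Set X} (hN : MeasurableSet N)
    (h0 : μ N = 0) : μ (g ⁻¹' N) = 0 := by
  obtain ⟨N', hN', h0', B, hB, hi, hc⟩ := exists_null_sigmaInjective (μ.map g) hg fun y =>
    (R.countable_classes y).mono fun x (hx : g x = y) => hx ▸ R.symm (hR x)
  rw [Measure.map_apply hg hN'] at h0'
  have hpiece : ∀ n, μ (B n ∩ g ⁻¹' N) = 0 := fun n => by
    rw [← hpmp.measure_image hg ((hB n).inter (hg hN)) ((hi n).mono Set.inter_subset_left)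
      fun x _ => hR x]
    exact measure_mono_null (Set.image_subset_iff.2 Set.inter_subset_right) h0
  refine measure_mono_null (fun x hx => ?_) (measure_union_null h0' (measure_iUnion_null hpiece))
  by_cases h : g x ∈ N'
  · exact Or.inl h
  · obtain ⟨n, hn⟩ := Set.mem_iUnion.1 (hc h)
    exact Or.inr (Set.mem_iUnion.2 ⟨n, hn, hx⟩)

/-- On an invariant conull Borel set, the classes of a measure preserving CBER are enumerated by
countably many measurable maps. -/
theorem IsPMP.exists_enumeration [IsFiniteMeasure μ] (hpmp : R.IsPMP μ)
    (hdom : R.dom = Set.univ) :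
    ∃ (Y : Set X) (g : ℕ → X → X), MeasurableSet Y ∧ μ Yᶜ = 0 ∧
      (∀ x ∈ Y, ∀ y, R.rel x y → y ∈ Y) ∧ (∀ n, Measurable (g n)) ∧
      ∀ x ∈ Y, ∀ y, R.rel x y → ∃ n, g n x = y := by
  have := R.rel_meas.standardBorel
  obtain ⟨N, hN, h0, B, hB, hi, hc⟩ := exists_null_sigmaInjective μ
    (f := fun p : {p : X × X | R.rel p.1 p.2} => p.1.1)
    (measurable_fst.comp measurable_subtype_coe) fun x => by
      have hinj : Set.InjOn (fun p : {p : X × X | R.rel p.1 p.2} => p.1.2)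
          ((fun p : {p : X × X | R.rel p.1 p.2} => p.1.1) ⁻¹' {x}) := by
        intro p hp q hq h
        exact Subtype.ext (Prod.ext (hp.trans hq.symm) h)
      refine Set.MapsTo.countable_of_injOn ?_ hinj (R.countable_classes x)
      rintro ⟨⟨a, b⟩, hab⟩ rfl
      exact hab
  choose g hg hgB hgid using fun n => exists_measurable_extension
    (p := fun p : {p : X × X | R.rel p.1 p.2} => p.1.1)
    (q := fun p : {p : X × X | R.rel p.1 p.2} => p.1.2)
    (measurable_fst.comp measurable_subtype_coe)
    (measurable_snd.comp measurable_subtype_coe) (hB n) (hi n)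
  have hgR : ∀ n x, R.rel x (g n x) := by
    intro n x
    by_cases h : x ∈ (fun p : {p : X × X | R.rel p.1 p.2} => p.1.1) '' B n
    · obtain ⟨p, hp, rfl⟩ := h
      have hp' : g n p.1.1 = p.1.2 := hgB n p hp
      simp only [hp']
      exact p.2
    · rw [hgid n x h]
      exact R.refl x (hdom ▸ Set.mem_univ x)
  have hgs : ∀ x ∉ N, ∀ y, R.rel x y → ∃ n, g n x = y := by
    intro x hx y hxy
    obtain ⟨n, hn⟩ := Set.mem_iUnion.1 (@hc ⟨(x, y), hxy⟩ hx)
    exact ⟨n, hgB n _ hn⟩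
  refine ⟨Nᶜ ∩ ⋂ n, g n ⁻¹' Nᶜ, g, ?_, ?_, ?_, hg, fun x hx => hgs x hx.1⟩
  · exact hN.compl.inter (MeasurableSet.iInter fun n => hg n hN.compl)
  · refine measure_mono_null (fun x hx => ?_) (measure_union_null h0 (measure_iUnion_null
      fun n => hpmp.measure_preimage_null (hg n) (hgR n) hN h0))
    by_contra h
    simp only [Set.mem_union, Set.mem_iUnion, not_or, not_exists] at h
    exact hx ⟨h.1, Set.mem_iInter.2 h.2⟩
  · rintro x ⟨hx, hxg⟩ y hxy
    have hcl : ∀ z, R.rel x z → z ∉ N := by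
      intro z hz
      obtain ⟨n, rfl⟩ := hgs x hx z hz
      exact Set.mem_iInter.1 hxg n
    exact ⟨hcl y hxy, Set.mem_iInter.2 fun n => hcl _ (R.trans hxy (hgR n y))⟩

/-- An aperiodic subrelation of a finite measure preserving CBER with a Borel fundamental domain
lives on a null set. -/
theorem IsPMP.measure_zero_of_fundamentalDomain [IsFiniteMeasure μ] (hpmp : R.IsPMP μ)
    {S : CBER X} (hSR : ∀ x y, S.rel x y → R.rel x y) {Y D : Set X} (hD : MeasurableSet D)
    {g : ℕ → X → X} (hg : ∀ n, Measurable (g n))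
    (hgs : ∀ x ∈ D, ∀ y, S.rel x y → ∃ n, g n x = y) (hinf : ∀ x ∈ D, (S.cls x).Infinite)
    (hex : ∀ y ∈ Y, ∃ x ∈ D, S.rel x y)
    (huniq : ∀ x ∈ D, ∀ x' ∈ D, S.rel x x' → x = x') : μ Y = 0 := by
  let A : ℕ → Set X := fun n => D ∩ {x | S.rel x (g n x)} ∩ ⋂ m, ⋂ _ : m < n, {x | g m x ≠ g n x}
  have hA : ∀ n, MeasurableSet (A n) := by
    let := upgradeStandardBorel X
    intro n
    refine (hD.inter ((measurable_id.prodMk (hg n)) S.rel_meas)).inter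
      (MeasurableSet.iInter fun m => MeasurableSet.iInter fun _ => ?_)
    exact (measurableSet_eq_fun (hg m) (hg n)).compl
  have hcov : ∀ x ∈ D, ∀ y, S.rel x y → ∃ n, x ∈ A n ∧ g n x = y := by
    classical
    intro x hx y hxy
    have h := hgs x hx y hxy
    refine ⟨Nat.find h, ⟨⟨hx, ?_⟩, ?_⟩, Nat.find_spec h⟩
    · show S.rel x (g (Nat.find h) x)
      rw [Nat.find_spec h]
      exact hxy
    · refine Set.mem_iInter.2 fun m => Set.mem_iInter.2 fun hm => ?_
      show g m x ≠ g (Nat.find h) x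
      rw [Nat.find_spec h]
      exact Nat.find_min h hm
  have hbase : ∀ n m, ∀ x ∈ A n, ∀ x' ∈ A m, g n x = g m x' → x = x' := by
    intro n m x hx x' hx' h
    refine huniq x hx.1.1 x' hx'.1.1 (S.trans hx.1.2 ?_)
    rw [h]
    exact S.symm hx'.1.2
  have hinj : ∀ n, Set.InjOn (g n) (A n) := fun n x hx x' hx' h => hbase n n x hx x' hx' h
  have himg : ∀ n, μ (g n '' A n) = μ (A n) := fun n =>
    hpmp.measure_image (hg n) (hA n) (hinj n) fun x hx => hSR _ _ hx.1.2
  have hdisj : Pairwise (Function.onFun Disjoint fun n => g n '' A n) := by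
    intro n m hnm
    refine Set.disjoint_left.2 ?_
    rintro _ ⟨x, hx, rfl⟩ ⟨x', hx', h⟩
    obtain rfl := hbase m n x' hx' x hx h
    rcases lt_or_gt_of_ne hnm with hlt | hlt
    · exact Set.mem_iInter₂.1 hx'.2 n hlt h.symm
    · exact Set.mem_iInter₂.1 hx.2 m hlt h
  have hsum : ∑' n, μ (A n) ≠ ⊤ := by
    simp_rw [← himg]
    rw [← measure_iUnion hdisj fun n => (hA n).image_of_measurable_injOn (hg n) (hinj n)]
    exact measure_ne_top _ _
  have hD0 : μ D = 0 := by
    refine measure_mono_null (fun x hx => ?_) (measure_limsup_cofinite_eq_zero hsum)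
    rw [Filter.cofinite.limsup_set_eq]
    refine Set.Infinite.of_image (fun n => g n x) ((hinf x hx).mono fun y hy => ?_)
    obtain ⟨n, hn, rfl⟩ := hcov x hx y hy
    exact ⟨n, hn, rfl⟩
  refine measure_mono_null (fun y hy => ?_) (measure_iUnion_null fun n => (himg n).trans
    (measure_mono_null (fun x (hx : x ∈ A n) => hx.1.1) hD0))
  obtain ⟨x, hx, hxy⟩ := hex y hy
  obtain ⟨n, hn, rfl⟩ := hcov x hx y hxy
  exact Set.mem_iUnion.2 ⟨n, x, hn, rfl⟩

end CBER

section Combinatorics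

variable {X : Type} [MeasurableSpace X] {J : Type}

/-- Reduced paths: `ReducedPath Rf a x c z` says that `x` and `z` are joined by a nonempty path of
nontrivial steps in the factors, consecutive steps being in different factors, whose first step is
in `Rf a` and whose last step is in `Rf c`. -/
inductive ReducedPath (Rf : J → CBER X) : J → X → J → X → Prop
  | single {a : J} {x y : X} : x ≠ y → (Rf a).rel x y → ReducedPath Rf a x a y
  | cons {a b c : J} {x y z : X} : x ≠ y → (Rf a).rel x y → a ≠ b →
      ReducedPath Rf b y c z → ReducedPath Rf a x c z

namespace ReducedPath

variable {Rf : J → CBER X} {a b c : J} {x y z : X}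

theorem snoc (h : ReducedPath Rf a x b y) (hbc : b ≠ c) (hne : y ≠ z) (hr : (Rf c).rel y z) :
    ReducedPath Rf a x c z := by
  induction h with
  | single hxy hr' => exact .cons hxy hr' hbc (.single hne hr)
  | cons hxy hr' hab _ ih => exact .cons hxy hr' hab (ih hbc hne hr)

theorem symm (h : ReducedPath Rf a x c z) : ReducedPath Rf c z a x := by
  induction h with
  | single hxy hr => exact .single hxy.symm ((Rf _).symm hr)
  | cons hxy hr hab _ ih => exact ih.snoc hab.symm hxy.symm ((Rf _).symm hr)

theorem exists_sequence (h : ReducedPath Rf a x c z) :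
    ∃ (n : ℕ) (p : ℕ → X) (k : ℕ → J), p 0 = x ∧ p (n + 1) = z ∧ k 0 = a ∧
      (∀ j < n + 1, p j ≠ p (j + 1)) ∧ (∀ j < n + 1, (Rf (k j)).rel (p j) (p (j + 1))) ∧
      ∀ j < n, k j ≠ k (j + 1) := by
  induction h with
  | @single a x y hxy hr =>
    refine ⟨0, fun j => if j = 0 then x else y, fun _ => a, rfl, rfl, rfl, ?_, ?_, by simp⟩
    · simpa using hxy
    · simpa using hr
  | @cons a b c x y z hxy hr hab _ ih =>
    obtain ⟨n, p, k, hp0, hpn, hk0, hne, hrel, hk⟩ := ih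
    refine ⟨n + 1, fun j => Nat.casesOn j x p, fun j => Nat.casesOn j a k, rfl, hpn, rfl,
      ?_, ?_, ?_⟩
    · rintro (_ | j) hj
      · simpa [hp0] using hxy
      · exact hne j (by omega)
    · rintro (_ | j) hj
      · simpa [hp0] using hr
      · exact hrel j (by omega)
    · rintro (_ | j) hj
      · simpa [hk0] using hab
      · exact hk j (by omega)

theorem ne (hfi : FreelyIndep Rf) (h : ReducedPath Rf a x c z) : x ≠ z := by
  rintro rfl
  obtain ⟨n, p, k, hp0, hpn, -, hne, hrel, hk⟩ := h.exists_sequence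
  rcases Nat.eq_zero_or_pos n with rfl | hn
  · exact hne 0 (by omega) (hp0.trans hpn.symm)
  · obtain ⟨j, hj, hj'⟩ := hfi (n + 1) p k (by omega) (hpn.trans hp0.symm) hne hrel
    exact hk j (by omega) hj'

end ReducedPath

/-- `layer Rf U n a` is the set of points joined by a reduced path of length `n` to the
`Rf j`-saturation of some `U j`, the path not ending in `Rf j`, and starting in `Rf a` if `n ≠ 0`,
while `j = a` if `n = 0`. -/
def layer (Rf : J → CBER X) (U : J → Set X) : ℕ → J → Set X
  | 0, a => {x | ∃ u ∈ U a, (Rf a).rel x u}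
  | n + 1, a => {x | ∃ b, b ≠ a ∧ ∃ y ∈ layer Rf U n b, x ≠ y ∧ (Rf a).rel x y}

variable {Rf : J → CBER X} {U : J → Set X}

theorem exists_mem_layer_of_rel {n : ℕ} {a b : J} {x y : X} (hx : x ∈ layer Rf U n b)
    (h : (Rf a).rel x y) : ∃ m c, y ∈ layer Rf U m c := by
  by_cases hxy : y = x
  · exact ⟨n, b, hxy ▸ hx⟩
  by_cases hab : b = a
  · subst hab
    cases n with
    | zero =>
      obtain ⟨u, hu, hxu⟩ := hx
      exact ⟨0, b, u, hu, (Rf b).trans ((Rf b).symm h) hxu⟩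
    | succ n =>
      obtain ⟨c, hc, w, hw, -, hxw⟩ := hx
      by_cases hyw : y = w
      · exact ⟨n, c, hyw ▸ hw⟩
      · exact ⟨n + 1, b, c, hc, w, hw, hyw, (Rf b).trans ((Rf b).symm h) hxw⟩
  · exact ⟨n + 1, a, b, hab, x, hx, hxy, (Rf a).symm h⟩

theorem exists_mem_layer {R : CBER X} (hfp : IsFreeProduct R Rf) (htriv : Trivializes R Rf U)
    {x : X} (hx : x ∈ R.dom) : ∃ n b, x ∈ layer Rf U n b := by
  obtain ⟨-, hU, -, hsec, -, hloc⟩ := htriv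
  obtain ⟨u, hu, hxu⟩ := hsec x hx
  obtain ⟨j, hj⟩ := Set.mem_iUnion.1 hu
  have hiff : ∀ {y z : X}, Relation.EqvGen (fun a b => ∃ i, (Rf i).rel a b) y z →
      ((∃ n b, y ∈ layer Rf U n b) ↔ ∃ n b, z ∈ layer Rf U n b) := by
    intro y z h
    induction h with
    | rel y z h =>
      obtain ⟨a, h⟩ := h
      exact ⟨fun ⟨n, b, hy⟩ => exists_mem_layer_of_rel hy h,
        fun ⟨n, b, hz⟩ => exists_mem_layer_of_rel hz ((Rf a).symm h)⟩
    | refl => exact Iff.rfl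
    | symm _ _ _ ih => exact ih.symm
    | trans _ _ _ _ _ ih ih' => exact ih.trans ih'
  exact (hiff ((hfp.2.2 x u).1 hxu).2).2
    ⟨0, j, u, hj, (hloc j u hj u hj).1 (R.refl u (hU j hj))⟩

/-- A reduced path starting at a point of a layer can be prolonged backwards to the base layer. -/
theorem ReducedPath.extend {R : CBER X} (hsub : ∀ a x y, (Rf a).rel x y → R.rel x y)
    (hdom : R.dom = Set.univ) {n : ℕ} {a b c : J} {x z : X} (hx : x ∈ layer Rf U n b)
    (hab : b ≠ a) (h : ReducedPath Rf a x c z) :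
    ∃ y j d, y ∈ layer Rf U 0 j ∧ j ≠ d ∧ ReducedPath Rf d y c z ∧ R.rel y x := by
  induction n generalizing a b x with
  | zero => exact ⟨x, b, a, hx, hab, h, R.refl x (hdom ▸ Set.mem_univ x)⟩
  | succ n ih =>
    obtain ⟨b', hb', y, hy, hxy, hr⟩ := hx
    obtain ⟨w, j, d, hw, hjd, hp, hwy⟩ := ih hy hb' (.cons hxy.symm ((Rf b).symm hr) hab h)
    exact ⟨w, j, d, hw, hjd, hp, R.trans hwy (R.symm (hsub b _ _ hr))⟩

theorem rel_of_mem_layer_zero {R : CBER X} (hsub : ∀ a x y, (Rf a).rel x y → R.rel x y)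
    (htriv : Trivializes R Rf U) {j j' : J} {y y' : X} (hy : y ∈ layer Rf U 0 j)
    (hy' : y' ∈ layer Rf U 0 j') (h : R.rel y y') : j = j' ∧ (Rf j).rel y y' := by
  obtain ⟨u, hu, hyu⟩ := hy
  obtain ⟨u', hu', hyu'⟩ := hy'
  have huu : R.rel u u' :=
    R.trans (R.symm (hsub _ _ _ hyu)) (R.trans h (hsub _ _ _ hyu'))
  obtain rfl := htriv.2.2.2.2.1 j j' u hu u' hu' huu
  exact ⟨rfl, (Rf j).trans hyu
    ((Rf j).trans ((htriv.2.2.2.2.2 j u hu u' hu').1 huu) ((Rf j).symm hyu'))⟩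

theorem eq_of_mem_layer {R : CBER X} (hsub : ∀ a x y, (Rf a).rel x y → R.rel x y)
    (hdom : R.dom = Set.univ) (hfi : FreelyIndep Rf) (htriv : Trivializes R Rf U)
    {i b b' : J} {n n' : ℕ} {x x' : X} (hx : x ∈ layer Rf U n b) (hx' : x' ∈ layer Rf U n' b')
    (hb : b ≠ i) (hb' : b' ≠ i) (h : (Rf i).rel x x') : x = x' := by
  by_contra hne
  obtain ⟨y, j, d, hy, hjd, hp, hyx⟩ := (ReducedPath.single hne h).extend hsub hdom hx hb
  obtain ⟨y', j', d', hy', hjd', hp', hyx'⟩ := hp.symm.extend hsub hdom hx' hb'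
  have hyy : R.rel y y' := R.trans hyx (R.trans (hsub _ _ _ h) (R.symm hyx'))
  obtain ⟨rfl, hr⟩ := rel_of_mem_layer_zero hsub htriv hy hy' hyy
  by_cases hyy' : y = y'
  · exact hp'.ne hfi hyy'.symm
  · exact (ReducedPath.cons hyy' hr hjd' hp').ne hfi rfl

end Combinatorics

theorem measurableSet_inter_exists_rel {X : Type} [MeasurableSpace X] {R : CBER X} {Y : Set X}
    {g : ℕ → X → X} (hY : MeasurableSet Y) (hinv : ∀ x ∈ Y, ∀ y, R.rel x y → y ∈ Y)
    (hg : ∀ n, Measurable (g n)) (hgs : ∀ x ∈ Y, ∀ y, R.rel x y → ∃ n, g n x = y)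
    {P : X → X → Prop} (hP : MeasurableSet {p : X × X | P p.1 p.2})
    (hPR : ∀ x y, P x y → R.rel x y) {T : Set X} (hT : MeasurableSet (Y ∩ T)) :
    MeasurableSet (Y ∩ {x | ∃ y ∈ T, P x y}) := by
  have : Y ∩ {x | ∃ y ∈ T, P x y} = Y ∩ ⋃ n, {x | P x (g n x)} ∩ g n ⁻¹' (Y ∩ T) := by
    ext x
    refine and_congr_right fun hx => ?_
    simp only [Set.mem_ofPred_eq, Set.mem_iUnion, Set.mem_inter_iff, Set.mem_preimage]
    constructor
    · rintro ⟨y, hy, hxy⟩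
      obtain ⟨n, rfl⟩ := hgs x hx y (hPR x y hxy)
      exact ⟨n, hxy, hinv x hx _ (hPR _ _ hxy), hy⟩
    · rintro ⟨n, hxy, -, hy⟩
      exact ⟨_, hy, hxy⟩
  rw [this]
  exact hY.inter (MeasurableSet.iUnion fun n =>
    ((measurable_id.prodMk (hg n)) hP).inter (hg n hT))

theorem measurableSet_inter_layer {X : Type} [MeasurableSpace X] [StandardBorelSpace X]
    {J : Type} [Countable J] {R : CBER X} {Rf : J → CBER X} {U : J → Set X} {Y : Set X}
    {g : ℕ → X → X} (hsub : ∀ a x y, (Rf a).rel x y → R.rel x y) (hU : ∀ j, MeasurableSet (U j))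
    (hY : MeasurableSet Y) (hinv : ∀ x ∈ Y, ∀ y, R.rel x y → y ∈ Y)
    (hg : ∀ n, Measurable (g n)) (hgs : ∀ x ∈ Y, ∀ y, R.rel x y → ∃ n, g n x = y)
    (n : ℕ) (a : J) : MeasurableSet (Y ∩ layer Rf U n a) := by
  induction n generalizing a with
  | zero =>
    exact measurableSet_inter_exists_rel hY hinv hg hgs (Rf a).rel_meas (hsub a) (hY.inter (hU a))
  | succ n ih =>
    have hne : MeasurableSet {p : X × X | p.1 ≠ p.2 ∧ (Rf a).rel p.1 p.2} := by
      let := upgradeStandardBorel X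
      exact (measurableSet_eq_fun measurable_fst measurable_snd).compl.inter (Rf a).rel_meas
    have : Y ∩ layer Rf U (n + 1) a = ⋃ b, ⋃ _ : b ≠ a,
        Y ∩ {x | ∃ y ∈ layer Rf U n b, x ≠ y ∧ (Rf a).rel x y} := by
      ext x
      simp only [layer, Set.mem_inter_iff, Set.mem_ofPred_eq, Set.mem_iUnion, exists_prop]
      tauto
    rw [this]
    exact MeasurableSet.iUnion fun b => MeasurableSet.iUnion fun _ =>
      measurableSet_inter_exists_rel hY hinv hg hgs
        (P := fun x y => x ≠ y ∧ (Rf a).rel x y) hne (fun x y h => hsub a x y h.2) (ih b)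

/-- For a finite-measure-preserving free product `R = *ⱼ Rⱼ` trivialized by
`U = ⊔ⱼ Uⱼ`, if some factor `Rᵢ` has full domain and is aperiodic, then the `R`-saturation
of `Uᵢ` is conull and `R = Rᵢ` almost everywhere. -/
theorem aperiodic_full_factor_of_trivialized_decomposition
    {X : Type} [MeasurableSpace X] [StandardBorelSpace X]
    (μ : MeasureTheory.Measure X) [MeasureTheory.IsFiniteMeasure μ]
    {J : Type} [Countable J]
    (R : CBER X) (hpmp : R.IsPMP μ)
    (Rf : J → CBER X) (hfp : IsFreeProduct R Rf)
    (U : J → Set X) (htriv : Trivializes R Rf U)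
    (i : J) (hdom : (Rf i).dom = Set.univ) (hap : (Rf i).Aperiodic) :
    μ ((R.sat (U i))ᶜ) = 0 ∧
    ∃ C : Set X, MeasurableSet C ∧ μ Cᶜ = 0 ∧
      ∀ x ∈ C, ∀ y ∈ C, (R.rel x y ↔ (Rf i).rel x y) := by
  have hsub : ∀ a x y, (Rf a).rel x y → R.rel x y := fun a x y h => (hfp.2.2 x y).2
    ⟨hfp.2.1 ▸ Set.mem_iUnion.2 ⟨a, ((Rf a).rel_dom h).1⟩, .rel _ _ ⟨a, h⟩⟩
  have hRdom : R.dom = Set.univ := by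
    rw [hfp.2.1, Set.eq_univ_iff_forall]
    exact fun x => Set.mem_iUnion.2 ⟨i, hdom ▸ Set.mem_univ x⟩
  obtain ⟨Y, g, hY, hY0, hinv, hg, hgs⟩ := hpmp.exists_enumeration hRdom
  have hlayer := measurableSet_inter_layer hsub htriv.1 hY hinv hg hgs
  let Z : Set X := Y ∩ layer Rf U 0 i
  let D : Set X := (⋃ n, ⋃ b, ⋃ _ : b ≠ i, Y ∩ layer Rf U n b) \ Z
  have hD : MeasurableSet D := (MeasurableSet.iUnion fun n => MeasurableSet.iUnion fun b =>
    MeasurableSet.iUnion fun _ => hlayer n b).diff (hlayer 0 i)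
  have hDmem : ∀ x, x ∈ D ↔ x ∈ Y ∧ x ∉ layer Rf U 0 i ∧ ∃ n b, b ≠ i ∧ x ∈ layer Rf U n b := by
    intro x
    simp only [D, Z, Set.mem_sdiff, Set.mem_iUnion, Set.mem_inter_iff, exists_prop]
    tauto
  have hrest : μ (Y \ Z) = 0 := by
    refine hpmp.measure_zero_of_fundamentalDomain (hsub i) hD hg
      (fun x hx y hxy => hgs x ((hDmem x).1 hx).1 y (hsub i x y hxy))
      (fun x _ => hap x (hdom ▸ Set.mem_univ x)) ?_ ?_
    · rintro y ⟨hy, hyZ⟩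
      have hy0 : y ∉ layer Rf U 0 i := fun h => hyZ ⟨hy, h⟩
      obtain ⟨n, b, hn⟩ := exists_mem_layer hfp htriv (hRdom ▸ Set.mem_univ y)
      by_cases hb : b = i
      · subst hb
        cases n with
        | zero => exact absurd hn hy0
        | succ n =>
          obtain ⟨c, hc, x, hx, -, hyx⟩ := hn
          refine ⟨x, (hDmem x).2 ⟨hinv y hy x (hsub _ _ _ hyx), ?_, n, c, hc, hx⟩,
            (Rf b).symm hyx⟩
          rintro ⟨u, hu, hxu⟩
          exact hy0 ⟨u, hu, (Rf b).trans hyx hxu⟩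
      · exact ⟨y, (hDmem y).2 ⟨hy, hy0, n, b, hb, hn⟩, (Rf i).refl y (hdom ▸ Set.mem_univ y)⟩
    · intro x hx x' hx' h
      obtain ⟨-, -, n, b, hb, hn⟩ := (hDmem x).1 hx
      obtain ⟨-, -, n', b', hb', hn'⟩ := (hDmem x').1 hx'
      exact eq_of_mem_layer hsub hRdom hfp.1 htriv hn hn' hb hb' h
  have hZ0 : μ Zᶜ = 0 := by
    refine measure_mono_null (fun x hx => ?_) (measure_union_null hY0 hrest)
    by_cases h : x ∈ Y
    · exact Or.inr ⟨h, hx⟩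
    · exact Or.inl h
  refine ⟨measure_mono_null (Set.compl_subset_compl.2 ?_) hZ0, Z, hlayer 0 i, hZ0, ?_⟩
  · rintro x ⟨-, u, hu, hxu⟩
    exact ⟨u, hu, R.symm (hsub _ _ _ hxu)⟩
  · intro x hx y hy
    exact ⟨fun h => (rel_of_mem_layer_zero hsub htriv hx.2 hy.2 h).2, hsub i x y⟩
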